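/- Orbit convergence claim from the proof of Lemma 5.2: let d ≥ 3 and let p ∈ ℝ^{d+1} with last coordinate p_{d+1} = 1. If (uₙ) is a bounded sequence in ℝ^{d−2} and (tₙ) is a sequence of real numbers with tₙ → −∞, then the normalized orbit vectors (N'(tₙ,uₙ)·p)/‖N'(tₙ,uₙ)·p‖ converge to −e₁, the negative of the first standard basis vector of ℝ^{d+1} (i.e. the orbit β_n·p converges to the point [−e₁] of the projective sphere S^d). -/

import Mathlib

/-- Extension of a finite vector to `ℕ` by zero. -/
def vext {m : ℕ} (v : Fin m → ℝ) : ℕ → ℝ := fun k => if h : k < m then v ⟨k, h⟩ else 0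

/-- The squared euclidean norm `‖v‖²`. -/
noncomputable def sqNorm {m : ℕ} (v : Fin m → ℝ) : ℝ := ∑ k, v k ^ 2

/-- The matrix `N'(t,u) ∈ B'_d` (indices `0, …, d` here). -/
noncomputable def Npmat (d : ℕ) (t : ℝ) (u : Fin (d - 2) → ℝ) :
    Matrix (Fin (d + 1)) (Fin (d + 1)) ℝ :=
  Matrix.of fun i j =>
    if i = j then (if i.val = 1 then Real.exp t else 1)
    else if i.val = 0 ∧ 2 ≤ j.val ∧ j.val ≤ d - 1 then vext u (j.val - 2)
    else if i.val = 0 ∧ j.val = d then sqNorm u / 2 + t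
    else if 2 ≤ i.val ∧ i.val ≤ d - 1 ∧ j.val = d then vext u (i.val - 2)
    else 0

/-- The euclidean norm on `ℝ^{d+1}`. -/
noncomputable def eNorm (d : ℕ) (x : Fin (d + 1) → ℝ) : ℝ := Real.sqrt (∑ i, x i ^ 2)

/-- The first standard basis vector `e₁` of `ℝ^{d+1}`. -/
def stdE1 (d : ℕ) : Fin (d + 1) → ℝ := fun k => if k.val = 0 then 1 else 0

open Filter Topology in
/-- After rescaling by `-t → ∞`, the matrices `N'(t,u)` with `u` bounded converge to
`-E_{1,d+1}`. -/
theorem tendsto_inv_smul_Npmat {d : ℕ} (hd : 3 ≤ d) {t : ℕ → ℝ} {u : ℕ → Fin (d - 2) → ℝ}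
    {C : ℝ} (hu : ∀ n, Real.sqrt (sqNorm (u n)) ≤ C) (ht : Tendsto t atTop atBot) :
    Tendsto (fun n => (-t n)⁻¹ • Npmat d (t n) (u n)) atTop
      (𝓝 (Matrix.single 0 (Fin.last d) (-1))) := by
  have hs : Tendsto (fun n => (-t n)⁻¹) atTop (𝓝 0) :=
    (tendsto_neg_atBot_atTop.comp ht).inv_tendsto_atTop
  have hnn (n : ℕ) : 0 ≤ sqNorm (u n) := Finset.sum_nonneg fun _ _ => sq_nonneg _
  have hC : 0 ≤ C := (Real.sqrt_nonneg _).trans (hu 0)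
  have hq (n : ℕ) : sqNorm (u n) ≤ C ^ 2 := (Real.sqrt_le_left hC).1 (hu n)
  have hv (n k : ℕ) : |vext (u n) k| ≤ C := by
    unfold vext
    split_ifs with hk
    · exact abs_le_of_sq_le_sq ((Finset.single_le_sum (f := fun i => u n i ^ 2)
        (fun _ _ => sq_nonneg _) (Finset.mem_univ _)).trans (hq n)) hC
    · simpa using hC
  have hbdd {f : ℕ → ℝ} {B : ℝ} (hf : ∀ n, |f n| ≤ B) :
      Tendsto (fun n => (-t n)⁻¹ * f n) atTop (𝓝 0) :=
    hs.zero_mul_isBoundedUnder_le (isBoundedUnder_of ⟨B, hf⟩)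
  have hvz (k : ℕ) : Tendsto (fun n => (-t n)⁻¹ * vext (u n) k) atTop (𝓝 0) :=
    hbdd fun n => hv n k
  have hexp : Tendsto (fun n => (-t n)⁻¹ * Real.exp (t n)) atTop (𝓝 0) := by
    simpa using hs.mul (Real.tendsto_exp_atBot.comp ht)
  have hcorner : Tendsto (fun n => (-t n)⁻¹ * (sqNorm (u n) / 2 + t n)) atTop (𝓝 (-1)) := by
    have h : Tendsto (fun n => (-t n)⁻¹ * sqNorm (u n) * 2⁻¹ + -1) atTop (𝓝 (-1)) := by
      simpa using ((hbdd fun n => (abs_of_nonneg (hnn n)).trans_le (hq n)).mul_const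
        2⁻¹).add_const (-1)
    refine h.congr' ?_
    filter_upwards [ht.eventually_lt_atBot 0] with n hn
    have := hn.ne
    field_simp
    ring
  refine tendsto_pi_nhds.2 fun i => tendsto_pi_nhds.2 fun j => ?_
  by_cases hij : i.val = 0 ∧ j.val = d
  · obtain ⟨rfl, rfl⟩ : i = 0 ∧ j = Fin.last d := ⟨Fin.ext hij.1, Fin.ext hij.2⟩
    have h1 : (0 : Fin (d + 1)) ≠ Fin.last d := by simp [Fin.ext_iff]; omega
    have h2 : ¬ d ≤ d - 1 := by omega
    simpa [Npmat, h1, h2] using hcorner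
  · have hz : Matrix.single 0 (Fin.last d) (-1 : ℝ) i j = 0 :=
      Matrix.single_apply_of_ne _ _ _ _ _ fun h => hij ⟨by simp [← h.1], by simp [← h.2]⟩
    rw [hz]
    simp only [Matrix.smul_apply, Npmat, Matrix.of_apply, smul_eq_mul]
    split_ifs
    · exact hexp
    · simpa using hs
    · exact hvz _
    · exact hvz _
    · simp

theorem continuous_eNorm (d : ℕ) : Continuous (eNorm d) := by
  unfold eNorm
  fun_prop

theorem eNorm_smul {d : ℕ} {c : ℝ} (hc : 0 ≤ c) (x : Fin (d + 1) → ℝ) :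
    eNorm d (c • x) = c * eNorm d x := by
  simp only [eNorm, Pi.smul_apply, smul_eq_mul, mul_pow, ← Finset.mul_sum]
  rw [Real.sqrt_mul (sq_nonneg c), Real.sqrt_sq hc]

theorem eNorm_neg_stdE1 (d : ℕ) : eNorm d (-stdE1 d) = 1 := by
  simp [eNorm, stdE1]

/-- Orbit convergence claim from the proof of Lemma 5.2: for `p` in the affine patch
`p_{d+1} = 1`, if `(uₙ)` is bounded and `tₙ → −∞`, then the euclidean-normalized
vectors `N'(tₙ,uₙ)·p / ‖N'(tₙ,uₙ)·p‖` converge to `−e₁`. -/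
theorem Bpd_orbit_tendsto_neg_e1 (d : ℕ) (hd : 3 ≤ d)
    (p : Fin (d + 1) → ℝ) (hp : p (Fin.last d) = 1)
    (t : ℕ → ℝ) (u : ℕ → Fin (d - 2) → ℝ)
    (hu : ∃ Cb : ℝ, ∀ n, Real.sqrt (∑ i, u n i ^ 2) ≤ Cb)
    (ht : Filter.Tendsto t Filter.atTop Filter.atBot) :
    Filter.Tendsto
      (fun n => (eNorm d ((Npmat d (t n) (u n)).mulVec p))⁻¹ •
        (Npmat d (t n) (u n)).mulVec p)
      Filter.atTop (nhds (-(stdE1 d))) := by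
  obtain ⟨C, hC⟩ := hu
  have hlim : Filter.Tendsto (fun n => (-t n)⁻¹ • (Npmat d (t n) (u n)).mulVec p)
      Filter.atTop (nhds (-(stdE1 d))) := by
    have hcont : Continuous fun M : Matrix (Fin (d + 1)) (Fin (d + 1)) ℝ => M.mulVec p := by
      fun_prop
    have h := (hcont.tendsto _).comp (tendsto_inv_smul_Npmat hd hC ht)
    have he : (Matrix.single 0 (Fin.last d) (-1)).mulVec p = -stdE1 d := by
      ext i
      by_cases hi : i = 0 <;> simp [Matrix.single_mulVec, hp, stdE1, hi]
    rw [he] at h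
    simpa only [Function.comp_def, Matrix.smul_mulVec] using h
  have hnorm := (((continuous_eNorm d).tendsto _).comp hlim).inv₀
    (by simp [eNorm_neg_stdE1])
  have h := hnorm.smul hlim
  rw [eNorm_neg_stdE1, inv_one, one_smul] at h
  refine h.congr' ?_
  filter_upwards [ht.eventually_lt_atBot 0] with n hn
  have hpos : 0 < (-t n)⁻¹ := inv_pos.2 (neg_pos.2 hn)
  rw [Function.comp_apply, eNorm_smul hpos.le, smul_smul, mul_inv, mul_right_comm,
    inv_mul_cancel₀ hpos.ne', one_mul]
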